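/- Let K be a pure d-dimensional simplicial complex and L an induced subcomplex whose 1-skeleton is properly k-colored. Then there exists a simplicial complex K', obtained from K by a finite sequence of stellar subdivisions of edges, such that K' admits a proper max{k, d+1}-coloring of its 1-skeleton, L is an induced subcomplex of K', and the coloring of K' restricts to the given k-coloring on L. -/

import Mathlib

open Finset

variable {V : Type*} [DecidableEq V]

/-- A (finite abstract) simplicial complex: faces are nonempty and closed under
nonempty subsets. -/
def IsComplex (K : Finset (Finset V)) : Prop :=
  ∀ f ∈ K, f.Nonempty ∧ ∀ g, g ⊆ f → g.Nonempty → g ∈ K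

/-- `K` is pure of dimension `d`: every face is contained in a face with `d+1` vertices. -/
def IsPure (K : Finset (Finset V)) (d : ℕ) : Prop :=
  ∀ f ∈ K, ∃ σ ∈ K, f ⊆ σ ∧ σ.card = d + 1

/-- A facet of a pure `d`-complex: a face with `d+1` vertices. -/
def IsFacet (K : Finset (Finset V)) (d : ℕ) (σ : Finset V) : Prop :=
  σ ∈ K ∧ σ.card = d + 1

/-- Two facets are neighboring if they share a ridge (codimension-1 face). -/
def Neighboring (K : Finset (Finset V)) (d : ℕ) (σ τ : Finset V) : Prop :=
  IsFacet K d σ ∧ IsFacet K d τ ∧ (σ ∩ τ).card = d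

/-- The perspectivity `⟨σ,τ⟩` between neighboring facets: it fixes the common
vertices and sends the vertex `σ \ τ` to the vertex `τ \ σ`. -/
noncomputable def persp (σ τ : Finset V) (v : V) : V :=
  if v ∈ τ then v else if h : (τ \ σ).Nonempty then h.choose else v

/-- The projectivity along a facet path: the composition of consecutive perspectivities. -/
noncomputable def projAlong : List (Finset V) → V → V
  | [] => id
  | [_] => id
  | σ :: τ :: rest => fun v => projAlong (τ :: rest) (persp σ τ v)

/-- A facet path: a nonempty sequence of facets in which consecutive facets share a ridge. -/
def IsFacetPath (K : Finset (Finset V)) (d : ℕ) (γ : List (Finset V)) : Prop :=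
  γ ≠ [] ∧ (∀ σ ∈ γ, IsFacet K d σ) ∧ γ.Chain' (fun σ τ => (σ ∩ τ).card = d)

/-- `K` is strongly connected: any two facets are joined by a facet path. -/
def StronglyConnected (K : Finset (Finset V)) (d : ℕ) : Prop :=
  ∀ σ τ, IsFacet K d σ → IsFacet K d τ →
    ∃ γ, IsFacetPath K d γ ∧ γ.head? = some σ ∧ γ.getLast? = some τ

/-- `K` is locally strongly connected: the star of every face is strongly connected. -/
def LocallyStronglyConnected (K : Finset (Finset V)) (d : ℕ) : Prop :=
  ∀ f ∈ K, ∀ σ τ, IsFacet K d σ → IsFacet K d τ → f ⊆ σ → f ⊆ τ →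
    ∃ γ, IsFacetPath K d γ ∧ γ.head? = some σ ∧ γ.getLast? = some τ ∧ ∀ ρ ∈ γ, f ⊆ ρ

/-- The vertex set of a complex. -/
def vertexSet (K : Finset (Finset V)) : Finset V := K.biUnion id

/-- A proper coloring of the 1-skeleton of `K`: the endpoints of every edge
(2-element face) receive distinct colors. -/
def ProperColoring {α : Type*} (K : Finset (Finset V)) (c : V → α) : Prop :=
  ∀ v w, v ≠ w → ({v, w} : Finset V) ∈ K → c v ≠ c w

/-- A codimension-2 face `f` is odd if its link graph is not 2-colorable (not bipartite). -/
def OddFace (K : Finset (Finset V)) (f : Finset V) : Prop :=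
  ¬ ∃ b : V → Bool, ∀ w w', w ∉ f → w' ∉ f → w ≠ w' →
      f ∪ {w, w'} ∈ K → b w ≠ b w'

/-- Stellar subdivision of the edge `e` of `K` by the new vertex `u`:
faces not containing `e` are kept; every face containing `e` is replaced by the
cones of `u` over the faces of its boundary not containing `e`. -/
def stellarSub (K : Finset (Finset V)) (e : Finset V) (u : V) : Finset (Finset V) :=
  K.filter (fun f => ¬ e ⊆ f) ∪
    (K.filter fun f => e ⊆ f).biUnion fun f =>
      e.biUnion fun x => ((f.erase x).powerset).image fun g => insert u g

/-- `EdgeSubdivSeq K K'` : `K'` is obtained from `K` by a finite sequence of stellar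
subdivisions of edges (each subdividing vertex being a fresh vertex). -/
inductive EdgeSubdivSeq : Finset (Finset V) → Finset (Finset V) → Prop
  | refl (K : Finset (Finset V)) : EdgeSubdivSeq K K
  | step (K L : Finset (Finset V)) (e : Finset V) (u : V) :
      EdgeSubdivSeq K L → e ∈ L → e.card = 2 → u ∉ vertexSet L →
      EdgeSubdivSeq K (stellarSub L e u)

/-- A boundary ridge: a `(d-1)`-dimensional face contained in exactly one facet. -/
def IsBoundaryRidge (K : Finset (Finset V)) (d : ℕ) (g : Finset V) : Prop :=
  g ∈ K ∧ g.card = d ∧ (K.filter fun τ => τ.card = d + 1 ∧ g ⊆ τ).card = 1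

/-- `L` is an induced subcomplex of `K`. -/
def InducedSub (K L : Finset (Finset V)) : Prop :=
  L ⊆ K ∧ ∀ f ∈ K, (∀ v ∈ f, v ∈ vertexSet L) → f ∈ L

section ExtendColoring

theorem mem_stellarSub {K : Finset (Finset V)} {e h : Finset V} {u : V} :
    h ∈ stellarSub K e u ↔ (h ∈ K ∧ ¬ e ⊆ h) ∨
      ∃ f ∈ K, e ⊆ f ∧ ∃ x ∈ e, ∃ g ⊆ f.erase x, insert u g = h := by
  simp only [stellarSub, mem_union, mem_filter, mem_biUnion, mem_image, mem_powerset, and_assoc]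

theorem mem_vertexSet_of_mem {K : Finset (Finset V)} {f : Finset V} {v : V}
    (hf : f ∈ K) (hv : v ∈ f) : v ∈ vertexSet K :=
  mem_biUnion.2 ⟨f, hf, hv⟩

theorem InducedSub.vertexSet_subset {K L : Finset (Finset V)} (h : InducedSub K L) :
    vertexSet L ⊆ vertexSet K :=
  biUnion_subset_biUnion_of_subset_left _ h.1

theorem InducedSub.stellarSub {K L : Finset (Finset V)} (h : InducedSub K L) {e : Finset V}
    {u : V} (he : ¬ e ⊆ vertexSet L) (hu : u ∉ vertexSet K) :
    InducedSub (stellarSub K e u) L := by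
  refine ⟨fun f hf => mem_stellarSub.2 (.inl ⟨h.1 hf, fun hef => he fun v hv =>
    mem_vertexSet_of_mem hf (hef hv)⟩), fun f hf hfL => ?_⟩
  rcases mem_stellarSub.1 hf with ⟨hf, -⟩ | ⟨f', -, -, x, -, g, -, rfl⟩
  · exact h.2 f hf hfL
  · exact absurd (h.vertexSet_subset (hfL u (mem_insert_self u g))) hu

/-- The vertices of colour less than `i` are properly coloured, the vertices of `L` carry their
prescribed colour `c`, and a face has at most `m - i` vertices whose colour is not yet final. -/
structure IsPartialColoring (L : Finset (Finset V)) (c : V → ℕ) (m i : ℕ)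
    (K : Finset (Finset V)) (col : V → ℕ) : Prop where
  induced : InducedSub K L
  agree : ∀ v ∈ vertexSet L, col v = c v
  injOn : ∀ f ∈ K, ∀ v ∈ f, ∀ w ∈ f, v ≠ w → v ∈ vertexSet L → w ∈ vertexSet L → c v ≠ c w
  proper : ∀ v w, v ≠ w → ({v, w} : Finset V) ∈ K → col v < i → col v ≠ col w
  card_le : ∀ f ∈ K, #{v ∈ f | i ≤ col v} + i ≤ m

/-- The edges of `K` both of whose endpoints have colour `i`. -/
def monoEdges (K : Finset (Finset V)) (col : V → ℕ) (i : ℕ) : Finset (Finset V) :=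
  {e ∈ K | #e = 2 ∧ ∀ v ∈ e, col v = i}

theorem card_filter_insert_le {p q : V → Prop} [DecidablePred p] [DecidablePred q]
    {f g : Finset V} {u x : V} (hpq : ∀ v ∈ f, p v ↔ q v) (hx : x ∈ f) (hqx : q x)
    (hg : g ⊆ f.erase x) : #{v ∈ insert u g | p v} ≤ #{v ∈ f | q v} := by
  have hsub : ({v ∈ insert u g | p v} : Finset V) ⊆ insert u ({v ∈ f | q v}.erase x) := by
    intro v hv
    rw [mem_filter, mem_insert] at hv
    rcases hv with ⟨rfl | hv, hp⟩
    · exact mem_insert_self _ _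
    · have := mem_erase.1 (hg hv)
      exact mem_insert_of_mem (mem_erase.2
        ⟨this.1, mem_filter.2 ⟨this.2, (hpq v this.2).1 hp⟩⟩)
  have hmem : x ∈ ({v ∈ f | q v} : Finset V) := mem_filter.2 ⟨hx, hqx⟩
  calc _ ≤ _ := card_le_card hsub
    _ ≤ _ := card_insert_le _ _
    _ = _ := card_erase_add_one hmem

theorem IsPartialColoring.stellarSub {K L : Finset (Finset V)} {c col : V → ℕ} {m i : ℕ}
    (h : IsPartialColoring L c m i K col)
    (hi : ∀ f ∈ K, #{v ∈ f | i + 1 ≤ col v} + (i + 1) ≤ m) {e : Finset V} {u : V}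
    (he : e ∈ monoEdges K col i) (hu : u ∉ vertexSet K) :
    IsPartialColoring L c m i (stellarSub K e u) (Function.update col u (i + 1)) ∧
    (∀ f ∈ stellarSub K e u,
      #{v ∈ f | i + 1 ≤ Function.update col u (i + 1) v} + (i + 1) ≤ m) ∧
    monoEdges (stellarSub K e u) (Function.update col u (i + 1)) i ⊂ monoEdges K col i := by
  obtain ⟨heK, hecard, hecol⟩ := mem_filter.1 he
  have hupd : ∀ f ∈ K, ∀ v ∈ f, Function.update col u (i + 1) v = col v := fun f hf v hv =>
    Function.update_of_ne (fun hvu : v = u => hu (hvu ▸ mem_vertexSet_of_mem hf hv)) _ _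
  have huL : u ∉ vertexSet L := fun hL => hu (h.induced.vertexSet_subset hL)
  have heL : ¬ e ⊆ vertexSet L := by
    intro hsub
    obtain ⟨a, ha, b, hb, hab⟩ := one_lt_card.1 (by omega : 1 < #e)
    refine h.injOn e heK a ha b hb hab (hsub ha) (hsub hb) ?_
    rw [← h.agree a (hsub ha), ← h.agree b (hsub hb), hecol a ha, hecol b hb]
  have hbound : ∀ f ∈ K, e ⊆ f → #{v ∈ f | i + 1 ≤ col v} + 2 + i ≤ m := by
    intro f hf hef
    have hdisj : Disjoint ({v ∈ f | i + 1 ≤ col v} : Finset V) e :=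
      disjoint_left.2 fun v hv hve => by
        have := (mem_filter.1 hv).2
        have := hecol v hve
        omega
    have hsub : ({v ∈ f | i + 1 ≤ col v} : Finset V) ∪ e ⊆ {v ∈ f | i ≤ col v} := by
      intro v hv
      rcases mem_union.1 hv with hv | hv
      · have := mem_filter.1 hv
        exact mem_filter.2 ⟨this.1, by omega⟩
      · exact mem_filter.2 ⟨hef hv, (hecol v hv).ge⟩
    have := card_le_card hsub
    rw [card_union_of_disjoint hdisj] at this
    have := h.card_le f hf
    omega
  refine ⟨⟨h.induced.stellarSub heL hu, ?_, ?_, ?_, ?_⟩, ?_, ?_⟩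
  · intro v hv
    rw [Function.update_of_ne (fun hvu : v = u => huL (hvu ▸ hv)), h.agree v hv]
  · intro f hf v hv w hw hvw hvL hwL
    rcases mem_stellarSub.1 hf with ⟨hf, -⟩ | ⟨f', hf', -, x, -, g, hg, rfl⟩
    · exact h.injOn f hf v hv w hw hvw hvL hwL
    · have hmem : ∀ y ∈ insert u g, y ∈ vertexSet L → y ∈ f' := fun y hy hyL =>
        mem_of_mem_erase (hg (mem_of_mem_insert_of_ne hy fun hyu => huL (hyu ▸ hyL)))
      exact h.injOn f' hf' v (hmem v hv hvL) w (hmem w hw hwL) hvw hvL hwL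
  · intro v w hvw hvwK hlt
    rcases mem_stellarSub.1 hvwK with ⟨hf, -⟩ | ⟨f', hf', -, x, -, g, hg, heq⟩
    · rw [hupd _ hf v (by simp)] at hlt ⊢
      rw [hupd _ hf w (by simp)]
      exact h.proper v w hvw hf hlt
    · have hmem : u ∈ ({v, w} : Finset V) := heq ▸ mem_insert_self u g
      rcases mem_insert.1 hmem with rfl | hmem
      · rw [Function.update_self] at hlt
        omega
      · obtain rfl := mem_singleton.1 hmem
        rw [Function.update_self]
        omega
  · intro f hf
    rcases mem_stellarSub.1 hf with ⟨hf, -⟩ | ⟨f', hf', hef, x, hx, g, hg, rfl⟩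
    · rw [filter_congr fun v hv => by rw [hupd f hf v hv]]
      exact h.card_le f hf
    · refine le_trans (Nat.add_le_add_right ?_ i) (h.card_le f' hf')
      exact card_filter_insert_le (fun v hv => by rw [hupd f' hf' v hv]) (hef hx)
        (hecol x hx).ge hg
  · intro f hf
    rcases mem_stellarSub.1 hf with ⟨hf, -⟩ | ⟨f', hf', hef, x, hx, g, hg, rfl⟩
    · rw [filter_congr fun v hv => by rw [hupd f hf v hv]]
      exact hi f hf
    · have hsub : ({v ∈ insert u g | i + 1 ≤ Function.update col u (i + 1) v} : Finset V) ⊆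
          insert u {v ∈ f' | i + 1 ≤ col v} := by
        intro v hv
        rw [mem_filter, mem_insert] at hv
        rcases hv with ⟨rfl | hv, hp⟩
        · exact mem_insert_self _ _
        · have hvf := mem_of_mem_erase (hg hv)
          rw [hupd f' hf' v hvf] at hp
          exact mem_insert_of_mem (mem_filter.2 ⟨hvf, hp⟩)
      have := (card_le_card hsub).trans (card_insert_le _ _)
      have := hbound f' hf' hef
      omega
  · refine (ssubset_iff_of_subset fun f hf => ?_).2 ⟨e, he, fun hmem => ?_⟩
    · obtain ⟨hf, hcard, hcol⟩ := mem_filter.1 hf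
      rcases mem_stellarSub.1 hf with ⟨hf, -⟩ | ⟨f', -, -, x, -, g, -, rfl⟩
      · exact mem_filter.2 ⟨hf, hcard, fun v hv => by rw [← hupd f hf v hv, hcol v hv]⟩
      · have := hcol u (mem_insert_self u g)
        rw [Function.update_self] at this
        omega
    · rcases mem_stellarSub.1 (mem_filter.1 hmem).1 with ⟨-, hne⟩ | ⟨f', -, -, x, -, g, -, heq⟩
      · exact hne Subset.rfl
      · exact hu (mem_vertexSet_of_mem heK (heq ▸ mem_insert_self u g))

theorem IsPartialColoring.succ_of_monoEdges_eq_empty {K L : Finset (Finset V)} {c col : V → ℕ}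
    {m i : ℕ} (h : IsPartialColoring L c m i K col)
    (hi : ∀ f ∈ K, #{v ∈ f | i + 1 ≤ col v} + (i + 1) ≤ m) (he : monoEdges K col i = ∅) :
    IsPartialColoring L c m (i + 1) K col := by
  refine ⟨h.induced, h.agree, h.injOn, fun v w hvw hK hlt heq => ?_, hi⟩
  rcases Nat.lt_succ_iff_lt_or_eq.1 hlt with hlt | hv
  · exact h.proper v w hvw hK hlt heq
  · refine notMem_empty ({v, w} : Finset V) (he ▸ mem_filter.2 ⟨hK, card_pair hvw, ?_⟩)
    simp [hv, ← heq]

theorem IsPartialColoring.exists_subdivision_succ [Infinite V] {K₀ L : Finset (Finset V)}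
    {c : V → ℕ} {m i : ℕ} (n : ℕ) {K : Finset (Finset V)} {col : V → ℕ}
    (h : IsPartialColoring L c m i K col) (hseq : EdgeSubdivSeq K₀ K)
    (hi : ∀ f ∈ K, #{v ∈ f | i + 1 ≤ col v} + (i + 1) ≤ m) (hn : #(monoEdges K col i) ≤ n) :
    ∃ K' col', EdgeSubdivSeq K₀ K' ∧ IsPartialColoring L c m (i + 1) K' col' := by
  induction n generalizing K col with
  | zero =>
    exact ⟨K, col, hseq, h.succ_of_monoEdges_eq_empty hi (card_eq_zero.1 (Nat.le_zero.1 hn))⟩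
  | succ n ih =>
    rcases (monoEdges K col i).eq_empty_or_nonempty with he | ⟨e, he⟩
    · exact ⟨K, col, hseq, h.succ_of_monoEdges_eq_empty hi he⟩
    · obtain ⟨u, hu⟩ := Infinite.exists_notMem_finset (vertexSet K)
      obtain ⟨heK, hecard, -⟩ := mem_filter.1 he
      obtain ⟨h', hi', hlt⟩ := h.stellarSub hi he hu
      have := card_lt_card hlt
      exact ih h' (.step _ _ e u hseq heK hecard hu) hi' (by omega)

/-- Giving colour `i` to every vertex outside `L` without a final colour leaves at most
`m - (i + 1)` vertices of larger colour in every face. -/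
theorem IsPartialColoring.recolor {K L : Finset (Finset V)} {c col : V → ℕ} {m i : ℕ}
    (h : IsPartialColoring L c m i K col) (hc : ∀ v ∈ vertexSet L, c v < m) (him : i < m) :
    ∃ col', IsPartialColoring L c m i K col' ∧
      ∀ f ∈ K, #{v ∈ f | i + 1 ≤ col' v} + (i + 1) ≤ m := by
  obtain ⟨col', hL, hle, hlt⟩ : ∃ col' : V → ℕ, (∀ v ∈ vertexSet L, col' v = col v) ∧
      (∀ v ∉ vertexSet L, i ≤ col v → col' v = i) ∧ (∀ v, col v < i → col' v = col v) := by
    refine ⟨fun v => if v ∉ vertexSet L ∧ i ≤ col v then i else col v, ?_, ?_, ?_⟩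
    · intro v hv
      simp [hv]
    · intro v hv hi
      simp [hv, hi]
    · intro v hi
      simp [not_le.2 hi]
  have hiff : ∀ v, i ≤ col' v ↔ i ≤ col v := by
    intro v
    rcases lt_or_ge (col v) i with hv | hv
    · rw [hlt v hv]
    · by_cases hvL : v ∈ vertexSet L
      · rw [hL v hvL]
      · simp [hle v hvL hv, hv]
  have hcol : IsPartialColoring L c m i K col' := by
    refine ⟨h.induced, fun v hv => (hL v hv).trans (h.agree v hv), h.injOn, ?_, ?_⟩
    · intro v w hvw hK hv
      have hv' : col v < i := by
        have := hiff v
        omega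
      have := h.proper v w hvw hK hv'
      rw [hlt v hv']
      rcases lt_or_ge (col w) i with hw | hw
      · rwa [hlt w hw]
      · have := (hiff w).2 hw
        omega
    · intro f hf
      simpa only [hiff] using h.card_le f hf
  refine ⟨col', hcol, fun f hf => ?_⟩
  by_cases hex : ∃ x ∈ f, col' x = i
  · obtain ⟨x, hx, hxi⟩ := hex
    have hss : ({v ∈ f | i + 1 ≤ col' v} : Finset V) ⊂ {v ∈ f | i ≤ col' v} := by
      refine (ssubset_iff_of_subset fun v hv => ?_).2
        ⟨x, mem_filter.2 ⟨hx, hxi.ge⟩, fun hmem => ?_⟩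
      · have := mem_filter.1 hv
        exact mem_filter.2 ⟨this.1, by omega⟩
      · have := (mem_filter.1 hmem).2
        omega
    have := card_lt_card hss
    have := hcol.card_le f hf
    omega
  · have hmemL : ∀ v ∈ ({v ∈ f | i + 1 ≤ col' v} : Finset V), v ∈ vertexSet L := by
      intro v hv
      by_contra hvL
      obtain ⟨hvf, hvi⟩ := mem_filter.1 hv
      exact hex ⟨v, hvf, hle v hvL ((hiff v).1 (by omega))⟩
    have hmaps : Set.MapsTo c ({v ∈ f | i + 1 ≤ col' v} : Finset V)
        (Finset.Ico (i + 1) m : Finset ℕ) := by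
      intro v hv
      have hvL := hmemL v hv
      have := (mem_filter.1 (mem_coe.1 hv)).2
      rw [hcol.agree v hvL] at this
      exact mem_coe.2 (mem_Ico.2 ⟨this, hc v hvL⟩)
    have hinj : Set.InjOn c ({v ∈ f | i + 1 ≤ col' v} : Finset V) := by
      intro v hv w hw heq
      by_contra hvw
      exact h.injOn f hf v (mem_filter.1 (mem_coe.1 hv)).1 w (mem_filter.1 (mem_coe.1 hw)).1 hvw
        (hmemL v hv) (hmemL w hw) heq
    have := card_le_card_of_injOn c hmaps hinj
    rw [Nat.card_Ico] at this
    omega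

theorem IsPartialColoring.exists_subdivision [Infinite V] {K L : Finset (Finset V)}
    {c col : V → ℕ} {m : ℕ} (h : IsPartialColoring L c m 0 K col)
    (hc : ∀ v ∈ vertexSet L, c v < m) {i : ℕ} (him : i ≤ m) :
    ∃ K' col', EdgeSubdivSeq K K' ∧ IsPartialColoring L c m i K' col' := by
  induction i with
  | zero => exact ⟨K, col, .refl K, h⟩
  | succ i ih =>
    obtain ⟨K', col', hseq, h'⟩ := ih (by omega)
    obtain ⟨col'', h'', hi⟩ := h'.recolor hc (by omega)
    exact h''.exists_subdivision_succ _ hseq hi le_rfl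

end ExtendColoring

/-- A proper `k`-coloring of an induced subcomplex `L` of a pure
`d`-complex `K` extends to a proper `max k (d+1)`-coloring of a refinement `K'` of `K`
obtained by finitely many stellar subdivisions of edges, with `L` still induced. -/
theorem extend_coloring
    [Infinite V]
    (K L : Finset (Finset V)) (d k : ℕ) (hK : IsComplex K) (hpure : IsPure K d)
    (hL : InducedSub K L) (c : V → Fin k) (hc : ProperColoring L c) :
    ∃ K' : Finset (Finset V), EdgeSubdivSeq K K' ∧ InducedSub K' L ∧
      ∃ c' : V → Fin (max k (d + 1)), ProperColoring K' c' ∧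
        ∀ v ∈ vertexSet L, (c' v : ℕ) = (c v : ℕ) := by
  have hck : ∀ v, (c v : ℕ) < max k (d + 1) := fun v => (c v).2.trans_le (le_max_left _ _)
  have hinit : IsPartialColoring L (fun v => (c v : ℕ)) (max k (d + 1)) 0 K
      (fun v => (c v : ℕ)) := by
    refine ⟨hL, fun _ _ => rfl, ?_, fun _ _ _ _ hlt => absurd hlt (Nat.not_lt_zero _), ?_⟩
    · intro f hf v hv w hw hvw hvL hwL heq
      have hpair : ({v, w} : Finset V) ∈ K :=
        (hK f hf).2 _ (insert_subset hv (singleton_subset_iff.2 hw)) (insert_nonempty _ _)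
      refine hc v w hvw (hL.2 _ hpair fun x hx => ?_) (Fin.ext heq)
      rcases mem_insert.1 hx with rfl | hx
      · exact hvL
      · exact mem_singleton.1 hx ▸ hwL
    · intro f hf
      obtain ⟨σ, -, hfσ, hσ⟩ := hpure f hf
      have := card_le_card ((filter_subset (fun v => 0 ≤ (c v : ℕ)) f).trans hfσ)
      exact le_max_of_le_right (by omega)
  obtain ⟨K', col, hseq, h⟩ := hinit.exists_subdivision (fun v _ => hck v) le_rfl
  have hlt : ∀ f ∈ K', ∀ v ∈ f, col v < max k (d + 1) := by
    intro f hf v hv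
    by_contra hcon
    have hmem : v ∈ ({w ∈ f | max k (d + 1) ≤ col w} : Finset V) :=
      mem_filter.2 ⟨hv, not_lt.1 hcon⟩
    have := card_pos.2 ⟨v, hmem⟩
    have := h.card_le f hf
    omega
  have hpos : 0 < max k (d + 1) := lt_max_of_lt_right d.succ_pos
  refine ⟨K', hseq, h.induced,
    fun v => if hv : col v < max k (d + 1) then ⟨col v, hv⟩ else ⟨0, hpos⟩, ?_, ?_⟩
  · intro v w hvw hK'
    have hv := hlt _ hK' v (by simp)
    have hw := hlt _ hK' w (by simp)
    simp only [hv, hw, dif_pos, ne_eq, Fin.mk.injEq]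
    exact h.proper v w hvw hK' hv
  · intro v hv
    have hcol := h.agree v hv
    have hv' : col v < max k (d + 1) := hcol ▸ hck v
    simp only [hv', dif_pos]
    exact hcol
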